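/- Let p be an odd prime and N a prime with N ≡ 1 (mod p). Then N ≡ 1 (mod p²) if and only if ζ_p lies in the image of the norm map Norm_{L/K} : L^× → K^×, where K = Q(ζ_p) and L = Q(ζ_p, N^{1/p}). -/

import Mathlib

open NumberField Polynomial

theorem padic_root (N : ℕ) [Fact N.Prime] (n : ℕ) (hn : n ∣ N - 1) :
    ∃ ζ : ℤ_[N], IsPrimitiveRoot ζ n := by
  have hN : N.Prime := Fact.out
  have hN1 : 0 < N - 1 := Nat.sub_pos_of_lt hN.one_lt
  obtain ⟨g, hg⟩ := IsCyclic.exists_generator (α := (ZMod N)ˣ)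
  have hord : orderOf g = N - 1 := by
    rw [orderOf_eq_card_of_forall_mem_zpowers hg, Nat.card_eq_fintype_card, ZMod.card_units]
  obtain ⟨a, ha⟩ : ∃ a : ℤ_[N], PadicInt.toZMod a = (g : ZMod N) :=
    ⟨((g : ZMod N).val : ℤ_[N]), by simp⟩
  have hlt : ∀ x : ℤ_[N], ‖x‖ < 1 ↔ PadicInt.toZMod x = 0 := by
    intro x
    rw [← RingHom.mem_ker, PadicInt.ker_toZMod, IsLocalRing.mem_maximalIdeal, PadicInt.mem_nonunits]
  have h1 : ∀ x : ℤ_[N], PadicInt.toZMod x ≠ 0 → ‖x‖ = 1 := by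
    intro x hx
    exact le_antisymm (PadicInt.norm_le_one x) (not_lt.mp (mt (hlt x).1 hx))
  let F : ℤ_[N][X] := X ^ (N - 1) - 1
  have hd : ‖(F.derivative).aeval a‖ = 1 := by
    apply h1
    simp only [F, derivative_sub, derivative_X_pow, derivative_one, sub_zero, map_mul, map_pow,
      aeval_X, aeval_C, ha]
    simp
    rw [Nat.cast_sub hN.one_lt.le]
    simp
  have hF : ‖F.aeval a‖ < ‖(F.derivative).aeval a‖ ^ 2 := by
    rw [hd, one_pow, hlt]
    simp only [F, map_sub, map_pow, aeval_X, map_one, ha]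
    rw [← Units.val_pow_eq_pow_val, ← hord, pow_orderOf_eq_one]; simp
  obtain ⟨z, hz, hza, -⟩ := hensels_lemma hF
  rw [hd, hlt, map_sub, ha, sub_eq_zero] at hza
  have hzp : z ^ (N - 1) = 1 := by
    simpa [F, sub_eq_zero] using hz
  have hprim : IsPrimitiveRoot z (N - 1) := by
    refine ⟨hzp, fun l hl => ?_⟩
    rw [← hord]
    apply orderOf_dvd_of_pow_eq_one
    ext
    rw [Units.val_pow_eq_pow_val, ← hza, ← map_pow, hl]; simp
  obtain ⟨m, hm⟩ := hn
  exact ⟨z ^ m, hprim.pow hN1 (by rw [hm, mul_comm])⟩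

theorem emb_mem (N : ℕ) [Fact N.Prime] (n : ℕ) (hn : n ∣ N - 1) (hn0 : 0 < n) {E Ω : Type*} [Field E]
    [Algebra ℚ E] [Field Ω] [Algebra ℚ_[N] Ω] (z : E) (hz : IsPrimitiveRoot z n)
    (hE : Algebra.adjoin ℚ {z} = (⊤ : Subalgebra ℚ E)) (φ : E →+* Ω) (x : E) :
    ∃ q : ℚ_[N], algebraMap ℚ_[N] Ω q = φ x := by
  obtain ⟨w, hw⟩ := padic_root N n hn
  have hw1 : IsPrimitiveRoot (algebraMap ℚ_[N] Ω (w : ℚ_[N])) n :=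
    (hw.map_of_injective (f := (PadicInt.Coe.ringHom : ℤ_[N] →+* ℚ_[N])) Subtype.val_injective).map_of_injective
      (algebraMap ℚ_[N] Ω).injective
  have hz1 : (φ z) ^ n = 1 := by rw [← map_pow, hz.pow_eq_one, map_one]
  have : NeZero n := ⟨hn0.ne'⟩
  obtain ⟨i, -, hi⟩ := hw1.eq_pow_of_pow_eq_one hz1
  have hx : x ∈ Algebra.adjoin ℚ {z} := by rw [hE]; trivial
  induction hx using Algebra.adjoin_induction with
  | mem y hy =>
    rw [Set.mem_singleton_iff] at hy
    exact ⟨(w : ℚ_[N]) ^ i, by rw [hy, ← hi, map_pow]⟩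
  | algebraMap r => exact ⟨(r : ℚ_[N]), by simp⟩
  | add x y _ _ hx hy =>
    obtain ⟨a, ha⟩ := hx
    obtain ⟨b, hb⟩ := hy
    exact ⟨a + b, by simp [ha, hb]⟩
  | mul x y _ _ hx hy =>
    obtain ⟨a, ha⟩ := hx
    obtain ⟨b, hb⟩ := hy
    exact ⟨a * b, by simp [ha, hb]⟩

theorem not_pth_power (p N : ℕ) (hp : p.Prime) [Fact N.Prime] (hd : p ∣ N - 1)
    {K : Type*} [Field K] [Algebra ℚ K] (ζ : K) (hζ : IsPrimitiveRoot ζ p)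
    (hKgen : Algebra.adjoin ℚ {ζ} = (⊤ : Subalgebra ℚ K))
    (φ : K →+* PadicAlgCl N) (b : K) : b ^ p ≠ (N : K) := by
  intro hb
  have hN : N.Prime := Fact.out
  obtain ⟨q, hq⟩ := emb_mem N p hd hp.pos ζ hζ hKgen φ b
  have h1 : q ^ p = (N : ℚ_[N]) := by
    apply (algebraMap ℚ_[N] (PadicAlgCl N)).injective
    rw [map_pow, hq, ← map_pow, hb]; simp
  have hq0 : q ≠ 0 := by
    rintro rfl
    rw [zero_pow hp.ne_zero] at h1
    exact hN.ne_zero (by exact_mod_cast h1.symm)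
  have h2 := congrArg Padic.valuation h1
  rw [Padic.valuation_pow] at h2
  simp at h2
  have : (p : ℤ) ∣ 1 := ⟨_, h2.symm⟩
  have := Int.eq_one_of_dvd_one (by positivity) this
  exact hp.one_lt.ne' (by exact_mod_cast this)

theorem kummer_irr (p N : ℕ) (hp : p.Prime) [Fact N.Prime] (hd : p ∣ N - 1)
    {K : Type*} [Field K] [Algebra ℚ K] [Algebra.IsAlgebraic ℚ K] (ζ : K) (hζ : IsPrimitiveRoot ζ p)
    (hKgen : Algebra.adjoin ℚ {ζ} = (⊤ : Subalgebra ℚ K)) :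
    Irreducible (X ^ p - C (N : K)) := by
  apply X_pow_sub_C_irreducible_of_prime hp
  have φ : K →ₐ[ℚ] PadicAlgCl N := IsAlgClosed.lift
  exact not_pth_power p N hp hd ζ hζ hKgen φ.toRingHom

theorem ultra_sum_lt {Ω ι : Type*} [NormedField Ω] [IsUltrametricDist Ω] (s : Finset ι) (f : ι → Ω)
    (C : ℝ) (hC : 0 < C) (h : ∀ i ∈ s, ‖f i‖ < C) : ‖∑ i ∈ s, f i‖ < C := by
  classical
  induction s using Finset.induction_on with
  | empty => simpa
  | insert a s ha ih =>
    rw [Finset.sum_insert ha]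
    refine lt_of_le_of_lt (IsUltrametricDist.norm_add_le_max _ _) (max_lt ?_ ?_)
    · exact h _ (by simp)
    · exact ih fun i hi => h i (by simp [hi])

theorem ultra_prod_congr {Ω ι : Type*} [NormedField Ω] [IsUltrametricDist Ω] (s : Finset ι)
    (f : ι → Ω) (b : Ω) (hb : ‖b‖ ≤ 1)
    (h : ∀ i ∈ s, ‖f i - b‖ < 1) : ‖∏ i ∈ s, f i - b ^ s.card‖ < 1 := by
  classical
  induction s using Finset.induction_on with
  | empty => simp
  | insert a s ha ih =>
    have ih' := ih fun i hi => h i (by simp [hi])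
    have ha' := h a (by simp)
    have hfa : ‖f a‖ ≤ 1 := by
      have : f a = (f a - b) + b := by ring
      rw [this]
      exact (IsUltrametricDist.norm_add_le_max _ _).trans (max_le ha'.le hb)
    rw [Finset.prod_insert ha, Finset.card_insert_of_notMem ha]
    have : f a * ∏ i ∈ s, f i - b ^ (s.card + 1) =
      f a * (∏ i ∈ s, f i - b ^ s.card) + (f a - b) * b ^ s.card := by ring
    rw [this]
    refine lt_of_le_of_lt (IsUltrametricDist.norm_add_le_max _ _) (max_lt ?_ ?_)
    · rw [norm_mul]
      exact mul_lt_one_of_nonneg_of_lt_one_right hfa (norm_nonneg _) ih'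
    · rw [norm_mul, norm_pow]
      exact mul_lt_one_of_nonneg_of_lt_one_left (norm_nonneg _) ha' (pow_le_one₀ (norm_nonneg _) hb)

theorem backward_padic (p N : ℕ) (hp : p.Prime) [Fact N.Prime] (hNp : N ≠ p)
    (z q : ℚ_[N]) (hz : IsPrimitiveRoot z p) (hq : ‖q‖ = 1) (h : ‖z - q ^ p‖ < 1) :
    p ^ 2 ∣ N - 1 := by
  have hN : N.Prime := Fact.out
  have hz1 : ‖z‖ = 1 := by
    have : ‖z‖ ^ p = 1 := by rw [← norm_pow, hz.pow_eq_one, norm_one]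
    exact (pow_eq_one_iff_of_nonneg (norm_nonneg _) hp.ne_zero).1 this
  let z' : ℤ_[N] := ⟨z, hz1.le⟩
  let q' : ℤ_[N] := ⟨q, hq.le⟩
  have hlt : ∀ x : ℤ_[N], ‖x‖ < 1 ↔ PadicInt.toZMod x = 0 := by
    intro x
    rw [← RingHom.mem_ker, PadicInt.ker_toZMod, IsLocalRing.mem_maximalIdeal, PadicInt.mem_nonunits]
  have h1 : PadicInt.toZMod z' = PadicInt.toZMod q' ^ p := by
    rw [← sub_eq_zero, ← map_pow, ← map_sub, ← hlt]
    exact h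
  have hsum : ∑ i ∈ Finset.range p, z' ^ i = 0 := by
    have hinj : Function.Injective (PadicInt.Coe.ringHom : ℤ_[N] →+* ℚ_[N]) := Subtype.val_injective
    apply hinj
    have := hz.geom_sum_eq_zero hp.one_lt
    rw [map_sum, map_zero]
    simp only [map_pow]
    exact this
  have hne : PadicInt.toZMod z' ≠ 1 := by
    intro h2
    have := congrArg PadicInt.toZMod hsum
    simp [map_sum, map_pow, h2] at this
    rw [ZMod.natCast_eq_zero_iff] at this
    exact hNp ((Nat.prime_dvd_prime_iff_eq hN hp).1 this)
  have hzp : z' ^ p = 1 := by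
    apply Subtype.val_injective
    have := hz.pow_eq_one
    push_cast
    exact this
  have hone : PadicInt.toZMod q' ^ p ^ 2 = 1 := by
    rw [pow_two, pow_mul, ← h1, ← map_pow, hzp, map_one]
  have : Fact p.Prime := ⟨hp⟩
  have hq0 : PadicInt.toZMod q' ≠ 0 := by
    intro h0
    rw [h0, zero_pow (pow_ne_zero _ hp.ne_zero)] at hone
    exact zero_ne_one hone
  have hord : orderOf (PadicInt.toZMod q') = p ^ (1 + 1) := by
    apply orderOf_eq_prime_pow
    · rwa [pow_one, ← h1]
    · exact hone
  rw [show p ^ 2 = orderOf (PadicInt.toZMod q') by rw [hord]]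
  exact orderOf_dvd_of_pow_eq_one (ZMod.pow_card_sub_one_eq_one hq0)

theorem finrank_L (p N : ℕ) (hp : p.Prime) 
    {K L : Type*} [Field K] [Field L] [Algebra K L] [FiniteDimensional K L]
    (irr : Irreducible (X ^ p - C (N : K)))
    (α : L) (hα : α ^ p = (N : L))
    (hLgen : Algebra.adjoin K {α} = (⊤ : Subalgebra K L)) :
    Module.finrank K L = p ∧ minpoly K α = X ^ p - C (N : K) := by
  have hm : minpoly K α = X ^ p - C (N : K) := by
    symm
    apply minpoly.eq_of_irreducible_of_monic irr
    · simp [hα]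
    · exact monic_X_pow_sub_C _ hp.ne_zero
  refine ⟨?_, hm⟩
  have hi : IsIntegral K α := Algebra.IsIntegral.isIntegral α
  have := IntermediateField.adjoin.finrank hi
  rw [hm, natDegree_X_pow_sub_C] at this
  have htop : IntermediateField.adjoin K {α} = ⊤ := by
    rw [← IntermediateField.toSubalgebra_inj, IntermediateField.adjoin_simple_toSubalgebra_of_isAlgebraic hi.isAlgebraic,
      hLgen]
    rfl
  rw [htop, IntermediateField.finrank_top'] at this
  exact this

theorem backward (p N : ℕ) (hp : p.Prime) [Fact N.Prime] (hNp : N ≠ p) (hd : p ∣ N - 1)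
    (K L : Type) [Field K] [NumberField K] [Field L] [NumberField L] [Algebra K L]
    (ζ : K) (hζ : IsPrimitiveRoot ζ p)
    (hKgen : Algebra.adjoin ℚ {ζ} = (⊤ : Subalgebra ℚ K))
    (α : L) (hα : α ^ p = (N : L))
    (hLgen : Algebra.adjoin K {α} = (⊤ : Subalgebra K L)) (x : L) (hx : Algebra.norm K x = ζ) :
    p ^ 2 ∣ N - 1 := by
  have hN : N.Prime := Fact.out
  have irr := kummer_irr p N hp hd ζ hζ hKgen
  obtain ⟨hfin, hmin⟩ := finrank_L p N hp irr α hα hLgen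
  obtain ⟨c, hc⟩ : ∃ c : ℕ → K, x = ∑ j ∈ Finset.range p, algebraMap K L (c j) * α ^ j := by
    have hxm : x ∈ Algebra.adjoin K {α} := by rw [hLgen]; trivial
    rw [Algebra.adjoin_singleton_eq_range_aeval] at hxm
    obtain ⟨f, hf⟩ := hxm
    have hf' : aeval α f = x := hf
    have hmon : (X ^ p - C (N : K)).Monic := monic_X_pow_sub_C _ hp.ne_zero
    have hdeg : (f %ₘ (X ^ p - C (N : K))).natDegree < p := by
      have := natDegree_modByMonic_lt f hmon (by
        intro h
        have := congrArg natDegree h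
        rw [natDegree_X_pow_sub_C, natDegree_one] at this
        exact hp.ne_zero this)
      rwa [natDegree_X_pow_sub_C] at this
    refine ⟨(f %ₘ (X ^ p - C (N : K))).coeff, ?_⟩
    have h0 : aeval α (X ^ p - C (N : K)) = 0 := by simp [hα]
    rw [← hf', ← aeval_modByMonic_eq_self_of_root h0, aeval_eq_sum_range' hdeg]
    simp [Algebra.smul_def]
  let φ₀ : K →ₐ[ℚ] PadicAlgCl N := IsAlgClosed.lift
  let φ : K →+* PadicAlgCl N := φ₀.toRingHom
  let _ : Algebra K (PadicAlgCl N) := φ.toAlgebra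
  have hφ : ∀ k, algebraMap K (PadicAlgCl N) k = φ k := fun _ => rfl
  have hnormE : ∀ y : ℚ_[N], ‖algebraMap ℚ_[N] (PadicAlgCl N) y‖ = ‖y‖ := fun y =>
    PadicAlgCl.norm_extends N y
  choose q hq using fun k => emb_mem N p hd hp.pos ζ hζ hKgen φ k
  have hN1 : (1 : ℝ) < N := by exact_mod_cast hN.one_lt
  have hN0 : (0 : ℝ) < N := by linarith
  -- the norm of a root of `N`
  obtain ⟨r, hr0, hr⟩ : ∃ r : ℝ, 0 ≤ r ∧ r ^ p = (N : ℝ)⁻¹ := 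
    ⟨((N : ℝ)⁻¹) ^ ((p : ℝ)⁻¹), by positivity, Real.rpow_inv_natCast_pow (by positivity) hp.ne_zero⟩
  have hrpos : 0 < r := by
    rcases hr0.lt_or_eq with h | h
    · exact h
    · rw [← h, zero_pow hp.ne_zero] at hr
      have : (0 : ℝ) < (N : ℝ)⁻¹ := by positivity
      linarith
  have hβ : ∀ σ : L →ₐ[K] PadicAlgCl N, ‖σ α‖ = r := by
    intro σ
    have : ‖σ α‖ ^ p = r ^ p := by
      rw [← norm_pow, ← map_pow, hα, hr, map_natCast,
        ← map_natCast (algebraMap ℚ_[N] (PadicAlgCl N)), hnormE, Padic.norm_p]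
    exact (pow_left_inj₀ (norm_nonneg _) hr0 hp.ne_zero).1 this
  let n : ℕ → ℝ := fun j => ‖q (c j)‖ * r ^ j
  have hterm : ∀ (σ : L →ₐ[K] PadicAlgCl N) j, ‖σ (algebraMap K L (c j) * α ^ j)‖ = n j := by
    intro σ j
    rw [map_mul, map_pow, norm_mul, norm_pow, hβ, AlgHom.commutes, hφ, ← hq, hnormE]
  have hnpow : ∀ j, q (c j) ≠ 0 → n j ^ p = (N : ℝ) ^ (-(p * (q (c j)).valuation + j) : ℤ) := by
    intro j hj
    simp only [n]
    rw [mul_pow, ← pow_mul, mul_comm j p, pow_mul, hr, Padic.norm_eq_zpow_neg_valuation hj,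
      ← zpow_natCast, ← zpow_mul, inv_pow, ← zpow_natCast, ← zpow_neg, ← zpow_add₀ hN0.ne']
    congr 1
    ring
  have hinj : ∀ i < p, ∀ j < p, n i = n j → n i ≠ 0 → i = j := by
    intro i hi j hj hij h0
    have hi0 : q (c i) ≠ 0 := by
      intro h; apply h0; simp [n, h]
    have hj0 : q (c j) ≠ 0 := by
      intro h; apply h0; rw [hij]; simp [n, h]
    have h1 := hnpow i hi0
    rw [hij, hnpow j hj0] at h1
    have h2 := zpow_right_injective₀ hN0 hN1.ne' h1
    have h3 : (i : ℤ) % p = (j : ℤ) % p := by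
      have : (i : ℤ) = j + p * ((q (c j)).valuation - (q (c i)).valuation) := by
        linear_combination h2
      rw [this, Int.add_mul_emod_self_left]
    rw [Int.emod_eq_of_lt (by positivity) (by exact_mod_cast hi),
      Int.emod_eq_of_lt (by positivity) (by exact_mod_cast hj)] at h3
    exact_mod_cast h3
  obtain ⟨j0, hj0, hmax⟩ := Finset.exists_max_image (Finset.range p) n ⟨0, by simpa using hp.pos⟩
  have hnn : ∀ j, 0 ≤ n j := fun j => by positivity
  have hcard : Fintype.card (L →ₐ[K] PadicAlgCl N) = p := by
    rw [← hfin]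
    exact AlgHom.card K L (PadicAlgCl N)
  have hprod := Algebra.norm_eq_prod_embeddings K (PadicAlgCl N) x
  rw [hx, hφ] at hprod
  have hζn : ‖φ ζ‖ = 1 := by
    have : ‖φ ζ‖ ^ p = 1 := by rw [← norm_pow, ← map_pow, hζ.pow_eq_one, map_one, norm_one]
    exact (pow_eq_one_iff_of_nonneg (norm_nonneg _) hp.ne_zero).1 this
  have hMpos : n j0 ≠ 0 := by
    intro h0
    have hz : ∀ j ∈ Finset.range p, algebraMap K L (c j) * α ^ j = 0 := by
      intro j hj
      obtain ⟨σ⟩ : Nonempty (L →ₐ[K] PadicAlgCl N) := by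
        rw [← Fintype.card_pos_iff, hcard]; exact hp.pos
      have : n j = 0 := le_antisymm (h0 ▸ hmax j hj) (hnn j)
      rw [← hterm σ, norm_eq_zero, map_eq_zero] at this
      exact this
    rw [Finset.sum_eq_zero hz] at hc
    rw [hc] at hx
    have : Module.finrank K L ≠ 0 := by rw [hfin]; exact hp.ne_zero
    rw [Algebra.norm_zero] at hx
    exact hζ.ne_zero hp.ne_zero hx.symm
  have hlt : ∀ j ∈ (Finset.range p).erase j0, n j < n j0 := by
    intro j hj
    rw [Finset.mem_erase] at hj
    refine lt_of_le_of_ne (hmax j hj.2) fun h => hj.1 ?_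
    exact hinj j (Finset.mem_range.1 hj.2) j0 (Finset.mem_range.1 hj0) h (h ▸ hMpos)
  have hM0 : 0 < n j0 := lt_of_le_of_ne (hnn _) hMpos.symm
  have hsplit : ∀ σ : L →ₐ[K] PadicAlgCl N, 
      ‖σ x - σ (algebraMap K L (c j0) * α ^ j0)‖ < n j0 := by
    intro σ
    rw [hc, ← Finset.add_sum_erase _ _ hj0, map_add, add_sub_cancel_left, map_sum]
    apply ultra_sum_lt _ _ _ hM0
    intro i hi
    rw [hterm]
    exact hlt i hi
  have hσx : ∀ σ : L →ₐ[K] PadicAlgCl N, ‖σ x‖ = n j0 := by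
    intro σ
    have h1 := hsplit σ
    rw [← hterm σ j0] at h1 ⊢
    have h2 := IsUltrametricDist.norm_add_eq_max_of_norm_ne_norm h1.ne
    rw [sub_add_cancel, max_eq_right h1.le] at h2
    exact h2
  have hn1 : n j0 = 1 := by
    have := congrArg norm hprod
    rw [norm_prod, Finset.prod_congr rfl (fun σ _ => hσx σ), Finset.prod_const, Finset.card_univ,
      hcard, hζn] at this
    exact (pow_eq_one_iff_of_nonneg (hnn _) hp.ne_zero).1 this.symm
  have hq0 : q (c j0) ≠ 0 := by
    intro h; apply hMpos; simp [n, h]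
  have hj00 : j0 = 0 := by
    have h1 := hnpow j0 hq0
    rw [hn1, one_pow, ← zpow_zero (N : ℝ)] at h1
    have h2 := zpow_right_injective₀ hN0 hN1.ne' h1
    have h3 : (p : ℤ) ∣ j0 := ⟨-(q (c j0)).valuation, by linear_combination h2⟩
    have h4 : p ∣ j0 := by exact_mod_cast h3
    exact Nat.eq_zero_of_dvd_of_lt h4 (Finset.mem_range.1 hj0)
  subst hj00
  have hqn : ‖q (c 0)‖ = 1 := by simpa [n] using hn1
  have hfinal := ultra_prod_congr Finset.univ (fun σ : L →ₐ[K] PadicAlgCl N => σ x) (φ (c 0))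
    (by rw [← hq, hnormE, hqn]) (by
      intro σ _
      have := hsplit σ
      rw [hn1, pow_zero, mul_one, AlgHom.commutes, hφ] at this
      exact this)
  rw [← hprod, Finset.card_univ, hcard, ← hq, ← hq, ← map_pow, ← map_sub, hnormE] at hfinal
  refine backward_padic p N hp hNp (q ζ) (q (c 0)) ?_ hqn hfinal
  apply IsPrimitiveRoot.of_map_of_injective (f := algebraMap ℚ_[N] (PadicAlgCl N)) _ (algebraMap ℚ_[N] (PadicAlgCl N)).injective
  rw [hq]
  exact hζ.map_of_injective φ.injective

theorem prod_gal {G M : Type*} [Group G] [Fintype G] [CommMonoid M] (g : G)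
    (hg : orderOf g = Fintype.card G) (f : G → M) :
    ∏ s : G, f s = ∏ i ∈ Finset.range (orderOf g), f (g ^ i) := by
  classical
  have hinj : Set.InjOn (fun i => g ^ i) (Finset.range (orderOf g) : Set ℕ) := by
    intro a ha b hb hab
    exact pow_injOn_Iio_orderOf (by simpa using ha) (by simpa using hb) hab
  have himg : (Finset.range (orderOf g)).image (fun i => g ^ i) = Finset.univ := by
    apply Finset.eq_univ_of_card
    rw [Finset.card_image_of_injOn hinj, Finset.card_range, hg]
  rw [← himg, Finset.prod_image hinj]

theorem symbol_symm (p N : ℕ) (hp : p.Prime) (hN0 : N ≠ 0)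
    {K L : Type*} [Field K] [Field L] [Algebra K L] [FiniteDimensional K L]
    (irr : Irreducible (X ^ p - C (N : K)))
    (ζ : K) (hζ : IsPrimitiveRoot ζ p) [CharZero K]
    (α : L) (hα : α ^ p = (N : L))
    (hLgen : Algebra.adjoin K {α} = (⊤ : Subalgebra K L))
    {E : Type*} [Field E] [Algebra K E] (hE : Module.finrank K E = p)
    (z : E) (hz : z ^ p = algebraMap K E ζ) (σ : E ≃ₐ[K] E) (hσ : σ z = algebraMap K E ζ * z)
    (hσp : σ ^ p = 1) (γ : E) (hγ : ∏ i ∈ Finset.range p, (σ ^ i) γ = (N : E)) :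
    ∃ x : L, Algebra.norm K x = ζ := by
  obtain ⟨hfin, hmin⟩ := finrank_L p N hp irr α hα hLgen
  have hζ0 : ζ ≠ 0 := hζ.ne_zero hp.ne_zero
  have hi : IsIntegral K α := Algebra.IsIntegral.isIntegral α
  let pb : PowerBasis K L := PowerBasis.ofAdjoinEqTop hi hLgen
  have hpb : pb.gen = α := PowerBasis.ofAdjoinEqTop_gen hi hLgen
  have hα0 : α ≠ 0 := by
    rintro rfl
    rw [zero_pow hp.ne_zero] at hα
    have : CharZero L := charZero_of_injective_algebraMap (algebraMap K L).injective
    exact hN0 (by exact_mod_cast hα.symm)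
  -- the operator `Y`
  let Y : Module.End K E := (LinearMap.mulLeft K γ) ∘ₗ σ.toLinearMap
  have hY : ∀ v, Y v = γ * σ v := fun v => rfl
  have hYk : ∀ k v, (Y ^ k) v = (∏ i ∈ Finset.range k, (σ ^ i) γ) * (σ ^ k) v := by
    intro k
    induction k with
    | zero => intro v; simp
    | succ k ih =>
      intro v
      rw [pow_succ, Module.End.mul_apply, hY, ih, Finset.prod_range_succ, map_mul, pow_succ σ,
        AlgEquiv.mul_apply, mul_assoc]
  have hYp : Y ^ p = algebraMap K (Module.End K E) (N : K) := by
    ext v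
    rw [hYk, hγ, hσp, Module.algebraMap_end_apply, AlgEquiv.one_apply, Algebra.smul_def]
    simp
  let ρ : L →ₐ[K] Module.End K E := pb.lift Y (by
    rw [hpb, hmin]; simp [hYp])
  have hρα : ρ α = Y := by
    rw [← hpb]; exact pb.lift_gen _ _
  -- the automorphism `τ`
  let τ₀ : L →ₐ[K] L := pb.lift (algebraMap K L ζ⁻¹ * α) (by
    rw [hpb, hmin]
    simp only [map_sub, map_pow, aeval_X, aeval_C, mul_pow, hα]
    rw [← map_pow, inv_pow, hζ.pow_eq_one]; simp)
  have hτ₀ : τ₀ α = algebraMap K L ζ⁻¹ * α := by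
    conv_lhs => rw [← hpb]
    exact pb.lift_gen _ _
  let τ : L ≃ₐ[K] L := AlgEquiv.ofBijective τ₀ (Algebra.IsAlgebraic.algHom_bijective τ₀)
  have hτ : τ α = algebraMap K L ζ⁻¹ * α := hτ₀
  have hτk : ∀ k, (τ ^ k) α = algebraMap K L (ζ⁻¹ ^ k) * α := by
    intro k
    induction k with
    | zero => simp
    | succ k ih =>
      rw [pow_succ', AlgEquiv.mul_apply, ih, map_mul, AlgEquiv.commutes, hτ, ← mul_assoc, ← map_mul,
        pow_succ]
  -- Galois
  have htop : IntermediateField.adjoin K {α} = ⊤ := by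
    rw [← IntermediateField.toSubalgebra_inj, IntermediateField.adjoin_simple_toSubalgebra_of_isAlgebraic hi.isAlgebraic,
      hLgen]
    rfl
  have hprs : (primitiveRoots p K).Nonempty := ⟨ζ, (mem_primitiveRoots hp.pos).2 hζ⟩
  have hspl : IsSplittingField K L (X ^ p - C (N : K)) := by
    have := isSplittingField_X_pow_sub_C_of_root_adjoin_eq_top (K := K) (L := L) (a := (N : K)) (α := α)
      (by rw [hfin]; exact hprs) (by rw [hfin, hα]; simp) htop
    rwa [hfin] at this
  have hgal : IsGalois K L := isGalois_of_isSplittingField_X_pow_sub_C hprs irr L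
  have hcard : Fintype.card (L ≃ₐ[K] L) = p := by
    rw [← Nat.card_eq_fintype_card, IsGalois.card_aut_eq_finrank, hfin]
  have hord : orderOf τ = p := by
    have : Fact p.Prime := ⟨hp⟩
    apply orderOf_eq_prime
    · rw [← hcard, pow_card_eq_one]
    · intro h1
      have h2 := hτ
      rw [h1, AlgEquiv.one_apply] at h2
      have h3 : algebraMap K L ζ⁻¹ = 1 := by
        have : algebraMap K L ζ⁻¹ * α = 1 * α := by rw [← h2, one_mul]
        exact mul_right_cancel₀ hα0 this
      rw [map_eq_one_iff _ (algebraMap K L).injective, inv_eq_one] at h3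
      exact hζ.ne_one hp.one_lt h3
  have hnorm : ∀ x : L, algebraMap K L (Algebra.norm K x) = ∏ i ∈ Finset.range p, (τ ^ i) x := by
    intro x
    rw [Algebra.norm_eq_prod_automorphisms, prod_gal τ (by rw [hord, hcard]), hord]
  -- the twisted linearity
  have htw : ∀ l : L, ∀ v : E, z * ρ l v = ρ (τ l) (z * v) := by
    intro l
    have hl : l ∈ Algebra.adjoin K {α} := by rw [hLgen]; trivial
    induction hl using Algebra.adjoin_induction with
    | mem y hy =>
      rw [Set.mem_singleton_iff] at hy
      subst hy
      intro v
      rw [hτ, map_mul ρ, hρα, AlgHom.commutes, Module.End.mul_apply, hY, hY, map_mul σ, hσ,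
        Module.algebraMap_end_apply, Algebra.smul_def, map_inv₀]
      have : algebraMap K E ζ ≠ 0 := by simpa using hζ0
      field_simp
    | algebraMap r =>
      intro v
      rw [AlgEquiv.commutes, AlgHom.commutes, Module.algebraMap_end_apply, Module.algebraMap_end_apply,
        mul_smul_comm]
    | add x y _ _ hx hy =>
      intro v
      simp only [map_add, LinearMap.add_apply, mul_add, hx, hy]
    | mul x y _ _ hx hy =>
      intro v
      simp only [map_mul, Module.End.mul_apply, hx, hy]
  let e : L →ₗ[K] E := (LinearMap.applyₗ (1 : E)) ∘ₗ ρ.toLinearMap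
  have he : ∀ l, e l = ρ l 1 := fun l => rfl
  have hinj : Function.Injective e := by
    rw [← LinearMap.ker_eq_bot, LinearMap.ker_eq_bot']
    intro l hl
    by_contra hl0
    have h1 : ρ (l⁻¹ * l) (1 : E) = 0 := by
      rw [map_mul, Module.End.mul_apply, ← he, hl, map_zero]
    rw [inv_mul_cancel₀ hl0, map_one ρ, Module.End.one_apply] at h1
    exact one_ne_zero h1
  have : FiniteDimensional K E := FiniteDimensional.of_finrank_pos (by rw [hE]; exact hp.pos)
  have hsurj : Function.Surjective e :=
    (LinearMap.injective_iff_surjective_of_finrank_eq_finrank (by rw [hfin, hE])).1 hinj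
  obtain ⟨x, hx⟩ := hsurj z
  refine ⟨x, ?_⟩
  have hzk : ∀ k, z ^ k = e (∏ i ∈ Finset.range k, (τ ^ i) x) := by
    intro k
    induction k with
    | zero => simp [he]
    | succ k ih =>
      rw [pow_succ', ih, he, htw, mul_one, ← hx, he, ← Module.End.mul_apply, ← map_mul, ← he,
        Finset.prod_range_succ', map_prod]
      congr 2
      exact Finset.prod_congr rfl fun i _ => by rw [pow_succ', AlgEquiv.mul_apply]
  apply (algebraMap K L).injective
  apply hinj
  rw [hnorm, ← hzk, hz, he, AlgHom.commutes, Module.algebraMap_end_apply, Algebra.smul_def, mul_one]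

section ClassNumber

variable {F : Type} [Field F] [NumberField F]

theorem absNorm_map_equiv (s : 𝓞 F ≃+* 𝓞 F) (I : Ideal (𝓞 F)) :
    Ideal.absNorm (I.map s) = Ideal.absNorm I := by
  rw [Ideal.absNorm_apply, Ideal.absNorm_apply, Submodule.cardQuot_apply, Submodule.cardQuot_apply]
  exact (Nat.card_congr (Ideal.quotientEquiv I (I.map s) s rfl).toEquiv).symm

theorem invariant_pow (p : ℕ) [IsGalois ℚ F] (hF : Module.finrank ℚ F = p)
    (σ : F ≃ₐ[ℚ] F) (hσ : orderOf σ = p) (s : 𝓞 F ≃+* 𝓞 F) (hs : ∀ x : 𝓞 F, ((s x : 𝓞 F) : F) = σ x)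
    (J : Ideal (𝓞 F)) (hJ0 : J ≠ ⊥) (hJ : J.map s = J) :
    J ^ p = Ideal.span {((Ideal.absNorm J : ℕ) : 𝓞 F)} := by
  have hcard : Fintype.card (F ≃ₐ[ℚ] F) = p := by
    rw [← Nat.card_eq_fintype_card, IsGalois.card_aut_eq_finrank, hF]
  have hsJ : ∀ x ∈ J, s x ∈ J := by
    intro x hx
    have := Ideal.mem_map_of_mem s hx
    rwa [hJ] at this
  have hsk : ∀ k, ∀ x ∈ J, ∃ y ∈ J, ((y : 𝓞 F) : F) = (σ ^ k) (x : F) := by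
    intro k
    induction k with
    | zero => intro x hx; exact ⟨x, hx, by simp⟩
    | succ k ih =>
      intro x hx
      obtain ⟨y, hy, hyx⟩ := ih x hx
      exact ⟨s y, hsJ y hy, by rw [hs, hyx, pow_succ', AlgEquiv.mul_apply]⟩
  have hle : Ideal.span {((Ideal.absNorm J : ℕ) : 𝓞 F)} ≤ J ^ p := by
    have h1 : Ideal.span {((Ideal.absNorm J : ℕ) : 𝓞 F)} =
        Ideal.map (algebraMap ℤ (𝓞 F)) (Ideal.relNorm ℤ J) := by
      rw [Ideal.relNorm_int, Ideal.map_span, Set.image_singleton]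
      simp
    rw [h1, Ideal.map_relNorm, Ideal.span_le]
    rintro _ ⟨x, hx, rfl⟩
    choose y hyJ hy using fun k => hsk k x hx
    have h2 : (algebraMap ℤ (𝓞 F)) (Algebra.intNorm ℤ (𝓞 F) x) = ∏ i ∈ Finset.range p, y i := by
      apply RingOfIntegers.coe_injective
      rw [map_prod]
      simp only [hy]
      have h3 := Algebra.algebraMap_intNorm (A := ℤ) (K := ℚ) (L := F) (B := 𝓞 F) x
      have h4 := Algebra.norm_eq_prod_automorphisms ℚ (x : F)
      rw [prod_gal σ (by rw [hσ, hcard]), hσ] at h4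
      rw [← h4, ← h3, ← IsScalarTower.algebraMap_apply, ← IsScalarTower.algebraMap_apply]
    simp only [Function.comp, SetLike.mem_coe]
    rw [h2]
    have := Ideal.prod_mem_prod (s := Finset.range p) (I := fun _ => J) (x := y) (fun i _ => hyJ i)
    simpa using this
  obtain ⟨C, hC⟩ := Ideal.dvd_iff_le.2 hle
  have hn := congrArg Ideal.absNorm hC
  rw [map_mul, map_pow, Ideal.absNorm_span_singleton] at hn
  have hpos : Ideal.absNorm J ≠ 0 := by
    rwa [Ne, Ideal.absNorm_eq_zero_iff]
  have h5 : (Algebra.norm ℤ ((Ideal.absNorm J : ℕ) : 𝓞 F)).natAbs = Ideal.absNorm J ^ p := by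
    have := Algebra.norm_algebraMap (R := ℚ) (S := F) ((Ideal.absNorm J : ℕ) : ℚ)
    have h6 : Algebra.norm ℤ ((Ideal.absNorm J : ℕ) : 𝓞 F) = (Ideal.absNorm J : ℤ) ^ p := by
      have h7 : ((Algebra.norm ℤ ((Ideal.absNorm J : ℕ) : 𝓞 F) : ℤ) : ℚ) = (Ideal.absNorm J : ℚ) ^ p := by
        rw [Algebra.coe_norm_int, ← hF, ← this]
        simp
      exact_mod_cast h7
    rw [h6]
    simp [Int.natAbs_pow]
  rw [h5] at hn
  have hC1 : Ideal.absNorm C = 1 := by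
    have : Ideal.absNorm J ^ p * 1 = Ideal.absNorm J ^ p * Ideal.absNorm C := by rw [mul_one, ← hn]
    exact (Nat.eq_of_mul_eq_mul_left (by positivity) this).symm
  rw [Ideal.absNorm_eq_one_iff] at hC1
  rw [hC, hC1, Ideal.mul_top]

theorem principal_of_pow (p : ℕ) (hp : p.Prime) (π : 𝓞 F)
    (hπ : Ideal.span {π} ^ p = Ideal.span {(p : 𝓞 F)})
    (H : ∀ (I : Ideal (𝓞 F)) (n : ℕ), n ≠ 0 → I ^ p = Ideal.span {(n : 𝓞 F)} →
      ∀ l : ℕ, l.Prime → l ≠ p → l ∣ n → l ^ p ∣ n) (n : ℕ) :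
    ∀ (I : Ideal (𝓞 F)), n ≠ 0 → I ^ p = Ideal.span {(n : 𝓞 F)} → Submodule.IsPrincipal I := by
  induction n using Nat.strong_induction_on with
  | _ n ih =>
  intro I hn hI
  by_cases h1 : n = 1
  · subst h1
    have h2 : I ^ p = 1 := by rw [hI]; simp
    have h3 : I = 1 := by
      rw [← isUnit_iff_eq_one] at h2 ⊢
      exact (isUnit_pow_iff hp.ne_zero).1 h2
    rw [h3, Ideal.one_eq_top]
    exact ⟨1, by simp⟩
  have key : ∀ (a : 𝓞 F) (m : ℕ), 1 < m → m ∣ n → Ideal.span {a} ^ p = Ideal.span {(m : 𝓞 F)} →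
      Submodule.IsPrincipal I := by
    rintro a m hm ⟨k, hk⟩ ha
    have hdvd : Ideal.span {a} ^ p ∣ I ^ p := by
      rw [hI, ha, hk, Nat.cast_mul, ← Ideal.span_singleton_mul_span_singleton]
      exact dvd_mul_right _ _
    obtain ⟨I', hI'⟩ := (UniqueFactorizationMonoid.pow_dvd_pow_iff_dvd hp.ne_zero).1 hdvd
    have hk0 : k ≠ 0 := by rintro rfl; simp at hk; exact hn hk
    have hm0 : Ideal.span {(m : 𝓞 F)} ≠ 0 := by
      rw [Ne, Ideal.zero_eq_bot, Ideal.span_singleton_eq_bot]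
      exact_mod_cast (by omega : m ≠ 0)
    have h2 : I' ^ p = Ideal.span {(k : 𝓞 F)} := by
      apply mul_left_cancel₀ hm0
      rw [Ideal.span_singleton_mul_span_singleton, ← Nat.cast_mul, ← hk, ← hI, hI', mul_pow, ha]
    have hklt : k < n := by
      rw [hk]; exact lt_mul_of_one_lt_left (Nat.pos_of_ne_zero hk0) hm
    obtain ⟨b, hb⟩ := (ih k hklt I' hk0 h2)
    refine ⟨a * b, ?_⟩
    rw [hI', hb]
    exact Ideal.span_singleton_mul_span_singleton a b
  obtain ⟨l, hl, hln⟩ := Nat.exists_prime_and_dvd h1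
  by_cases hlp : l = p
  · subst hlp
    exact key π l hl.one_lt hln hπ
  · refine key (l : 𝓞 F) (l ^ p) (Nat.one_lt_pow hp.ne_zero hl.one_lt) (H I n hn hI l hl hlp hln) ?_
    rw [Ideal.span_singleton_pow, Nat.cast_pow]

theorem fixed_principal (p : ℕ) (hp : p.Prime) (hpodd : Odd p) [IsGalois ℚ F]
    (hF : Module.finrank ℚ F = p)
    (σ : F ≃ₐ[ℚ] F) (hσ : orderOf σ = p) (s : 𝓞 F ≃+* 𝓞 F) (hs : ∀ x : 𝓞 F, ((s x : 𝓞 F) : F) = σ x)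
    (hprin : ∀ (I : Ideal (𝓞 F)) (n : ℕ), n ≠ 0 → I ^ p = Ideal.span {(n : 𝓞 F)} →
      Submodule.IsPrincipal I)
    (I : Ideal (𝓞 F)) (hI0 : I ≠ ⊥) (x y : 𝓞 F) (hx : x ≠ 0) (hy : y ≠ 0)
    (hxy : Ideal.span {x} * I.map s = Ideal.span {y} * I) : Submodule.IsPrincipal I := by
  have hcard : Nat.card (F ≃ₐ[ℚ] F) = p := by
    rw [IsGalois.card_aut_eq_finrank, hF]
  have hgen : ∀ g : F ≃ₐ[ℚ] F, g ∈ Subgroup.zpowers σ := by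
    intro g
    have : Subgroup.zpowers σ = ⊤ := by
      apply Subgroup.eq_top_of_card_eq
      rw [Nat.card_zpowers, hσ, hcard]
    rw [this]; trivial
  have hcyc : IsCyclic (F ≃ₐ[ℚ] F) := ⟨σ, hgen⟩
  have hpos : Ideal.absNorm I ≠ 0 := by rwa [Ne, Ideal.absNorm_eq_zero_iff]
  have hn := congrArg Ideal.absNorm hxy
  rw [map_mul, map_mul, absNorm_map_equiv, Ideal.absNorm_span_singleton,
    Ideal.absNorm_span_singleton] at hn
  have hn' := Nat.eq_of_mul_eq_mul_right (Nat.pos_of_ne_zero hpos) hn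
  -- change the sign
  obtain ⟨y', hy'0, hy'I, hy'n⟩ : ∃ y' : 𝓞 F, y' ≠ 0 ∧ Ideal.span {y'} = Ideal.span {y} ∧
      Algebra.norm ℤ x = Algebra.norm ℤ y' := by
    rcases Int.natAbs_eq_natAbs_iff.1 hn' with h | h
    · exact ⟨y, hy, rfl, h⟩
    · refine ⟨-y, neg_ne_zero.2 hy, Ideal.span_singleton_neg y, ?_⟩
      have h7 : ((Algebra.norm ℤ (-y) : ℤ) : ℚ) = ((- Algebra.norm ℤ y : ℤ) : ℚ) := by
        rw [Algebra.coe_norm_int, Int.cast_neg, Algebra.coe_norm_int]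
        have h8 : ((-y : 𝓞 F) : F) = algebraMap ℚ F (-1) * (y : F) := by simp
        rw [h8, map_mul, Algebra.norm_algebraMap, hF, hpodd.neg_one_pow]
        ring
      rw [h]
      exact_mod_cast h7.symm
  rw [← hy'I] at hxy
  have hxF : (x : F) ≠ 0 := by simpa using hx
  have hyF : (y' : F) ≠ 0 := by simpa using hy'0
  have hnorm1 : Algebra.norm ℚ ((y' : F) / (x : F)) = 1 := by
    rw [div_eq_mul_inv, map_mul, Algebra.norm_inv, ← Algebra.coe_norm_int, ← Algebra.coe_norm_int,
      hy'n, mul_inv_cancel₀]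
    rw [Algebra.coe_norm_int]
    exact Algebra.norm_ne_zero_iff.2 hyF
  obtain ⟨w, hw⟩ := groupCohomology.exists_div_of_norm_eq_one hgen hnorm1
  obtain ⟨a, b, hb0, hab'⟩ := IsFractionRing.div_surjective (A := 𝓞 F) (w : F)
  have hab : (a : F) / (b : F) = (w : F) := hab'
  have hb : b ≠ 0 := nonZeroDivisors.ne_zero hb0
  have hbF : (b : F) ≠ 0 := by simpa using hb
  have haF : (a : F) ≠ 0 := by
    intro h0
    apply w.ne_zero
    rw [← hab, h0, zero_div]
  -- multiply by the norm-like integer to get an invariant denominator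
  have hrel : y' * (s a) * b = x * a * s b := by
    apply RingOfIntegers.coe_injective
    simp only [map_mul, hs]
    rw [← hab, map_div₀] at hw
    have hsa : σ (a : F) ≠ 0 := by simpa using haF
    have hsb : σ (b : F) ≠ 0 := by simpa using hbF
    field_simp at hw
    linear_combination -hw
  -- denominators: `d = norm b` is rational and `b ∣ d`
  obtain ⟨b', d, hd0, hbd⟩ : ∃ (b' : 𝓞 F) (d : ℕ), d ≠ 0 ∧ b * b' = (d : 𝓞 F) := by
    have := Ideal.absNorm_mem (Ideal.span {b})
    rw [Ideal.mem_span_singleton] at this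
    obtain ⟨b', hb'⟩ := this
    refine ⟨b', _, ?_, hb'.symm⟩
    rw [Ne, Ideal.absNorm_eq_zero_iff, Ideal.span_singleton_eq_bot]
    exact hb
  have hb'0 : b' ≠ 0 := by
    rintro rfl
    rw [mul_zero] at hbd
    exact hd0 (by exact_mod_cast hbd.symm)
  have ha0 : a ≠ 0 := by rintro rfl; exact haF (by simp)
  have hsbb : s b * s b' = b * b' := by
    rw [← map_mul, hbd, map_natCast]
  let t := a * b'
  have ht0 : t ≠ 0 := mul_ne_zero ha0 hb'0
  have hrel2 : y' * s t = x * t := by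
    have hsb : s b ≠ 0 := by simpa using hb
    apply mul_left_cancel₀ (mul_ne_zero hb hsb)
    simp only [t, map_mul]
    linear_combination (s b * s b') * hrel + (x * a * s b) * hsbb
  let J := Ideal.span {t} * I
  have hJ0 : J ≠ ⊥ := by
    rw [← Ideal.zero_eq_bot]
    refine mul_ne_zero ?_ hI0
    rw [Ne, Ideal.zero_eq_bot, Ideal.span_singleton_eq_bot]
    exact ht0
  have hJ : J.map s = J := by
    have hy0 : Ideal.span {y'} ≠ 0 := by
      rw [Ne, Ideal.zero_eq_bot, Ideal.span_singleton_eq_bot]; exact hy'0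
    apply mul_left_cancel₀ hy0
    simp only [J]
    rw [Ideal.map_mul, Ideal.map_span, Set.image_singleton, ← mul_assoc,
      Ideal.span_singleton_mul_span_singleton, hrel2, ← Ideal.span_singleton_mul_span_singleton,
      mul_comm (Ideal.span {x}), mul_assoc, hxy]
    ring
  have hJn : Ideal.absNorm J ≠ 0 := by rwa [Ne, Ideal.absNorm_eq_zero_iff]
  obtain ⟨c, hc⟩ := hprin J _ hJn (invariant_pow p hF σ hσ s hs J hJ0 hJ)
  have hc' : Ideal.span {t} * I = Ideal.span {c} := hc
  have htc : t ∣ c := by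
    rw [← Ideal.span_singleton_le_span_singleton, ← hc']
    exact Ideal.dvd_iff_le.1 (dvd_mul_right _ _)
  obtain ⟨e, he⟩ := htc
  refine ⟨e, ?_⟩
  have ht : Ideal.span {t} ≠ 0 := by
    rw [Ne, Ideal.zero_eq_bot, Ideal.span_singleton_eq_bot]; exact ht0
  apply mul_left_cancel₀ ht
  rw [hc', he]
  exact (Ideal.span_singleton_mul_span_singleton t e).symm

theorem class_number_modEq (p : ℕ) (hp : p.Prime) 
    (s : 𝓞 F ≃+* 𝓞 F) (hsp : ∀ x, (s^[p]) x = x)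
    (hfix : ∀ (I : Ideal (𝓞 F)), I ≠ ⊥ → ∀ (x y : 𝓞 F), x ≠ 0 → y ≠ 0 →
      Ideal.span {x} * I.map s = Ideal.span {y} * I → Submodule.IsPrincipal I) :
    Fintype.card (ClassGroup (𝓞 F)) ≡ 1 [MOD p] := by
  classical
  have : Fact p.Prime := ⟨hp⟩
  have hmap0 : ∀ I : Ideal (𝓞 F), I ≠ ⊥ → I.map s ≠ ⊥ := by
    intro I hI h
    exact hI ((Ideal.map_eq_bot_iff_of_injective s.injective).1 h)
  let m : nonZeroDivisors (Ideal (𝓞 F)) → nonZeroDivisors (Ideal (𝓞 F)) := fun I =>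
    ⟨(I : Ideal (𝓞 F)).map s, mem_nonZeroDivisors_of_ne_zero
      (hmap0 _ (nonZeroDivisors.ne_zero I.2))⟩
  choose rep hrep using ClassGroup.mk0_surjective (R := 𝓞 F)
  let f : Function.End (ClassGroup (𝓞 F)) := fun c => ClassGroup.mk0 (m (rep c))
  have hf : ∀ I, f (ClassGroup.mk0 I) = ClassGroup.mk0 (m I) := by
    intro I
    have h1 := hrep (ClassGroup.mk0 I)
    rw [ClassGroup.mk0_eq_mk0_iff] at h1
    obtain ⟨x, y, hx, hy, h⟩ := h1
    change ClassGroup.mk0 (m (rep (ClassGroup.mk0 I))) = _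
    rw [ClassGroup.mk0_eq_mk0_iff]
    refine ⟨s x, s y, by simpa using hx, by simpa using hy, ?_⟩
    have h2 := congrArg (Ideal.map s) h
    rwa [Ideal.map_mul, Ideal.map_mul, Ideal.map_span, Ideal.map_span, Set.image_singleton,
      Set.image_singleton] at h2
  have hmk : ∀ k (I : nonZeroDivisors (Ideal (𝓞 F))) (x : 𝓞 F),
      x ∈ (I : Ideal (𝓞 F)) → s^[k] x ∈ ((m^[k] I : nonZeroDivisors (Ideal (𝓞 F))) : Ideal (𝓞 F)) := by
    intro k
    induction k with
    | zero => intro I x hx; simpa using hx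
    | succ k ih =>
      intro I x hx
      rw [Function.iterate_succ_apply, Function.iterate_succ_apply]
      exact ih _ _ (Ideal.mem_map_of_mem s hx)
  have hmn : ∀ k (I : nonZeroDivisors (Ideal (𝓞 F))),
      Ideal.absNorm ((m^[k] I : nonZeroDivisors (Ideal (𝓞 F))) : Ideal (𝓞 F)) =
        Ideal.absNorm (I : Ideal (𝓞 F)) := by
    intro k
    induction k with
    | zero => intro I; rfl
    | succ k ih =>
      intro I
      rw [Function.iterate_succ_apply, ih]
      exact absNorm_map_equiv s _
  have hmp : ∀ I, m^[p] I = I := by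
    intro I
    apply Subtype.ext
    have hle : (I : Ideal (𝓞 F)) ≤ (m^[p] I : nonZeroDivisors (Ideal (𝓞 F))) := by
      intro x hx
      have := hmk p I x hx
      rwa [hsp] at this
    obtain ⟨C, hC⟩ := Ideal.dvd_iff_le.2 hle
    have hn := congrArg Ideal.absNorm hC
    rw [map_mul, hmn] at hn
    have hpos : Ideal.absNorm (I : Ideal (𝓞 F)) ≠ 0 := by
      rw [Ne, Ideal.absNorm_eq_zero_iff]
      exact nonZeroDivisors.ne_zero I.2
    have hC1 : Ideal.absNorm C = 1 := by
      have : Ideal.absNorm (I : Ideal (𝓞 F)) * 1 = Ideal.absNorm (I : Ideal (𝓞 F)) * Ideal.absNorm C := by rw [mul_one, ← hn]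
      exact (Nat.eq_of_mul_eq_mul_left (Nat.pos_of_ne_zero hpos) this).symm
    rw [Ideal.absNorm_eq_one_iff] at hC1
    rw [hC1, Ideal.mul_top] at hC
    exact hC.symm
  have hfk : ∀ (k : ℕ) I, (f ^ k) (ClassGroup.mk0 I) = ClassGroup.mk0 (m^[k] I) := by
    intro k
    induction k with
    | zero => intro I; rfl
    | succ k ih =>
      intro I
      rw [pow_succ, Function.iterate_succ_apply]
      change (f ^ k) (f (ClassGroup.mk0 I)) = _
      rw [hf, ih]
  have hfp : f ^ p ^ 1 = 1 := by
    rw [pow_one]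
    funext c
    obtain ⟨I, rfl⟩ := ClassGroup.mk0_surjective c
    rw [hfk, hmp]; rfl
  have hmain := Equiv.Perm.card_fixedPoints_modEq hfp
  have hone : Fintype.card (Function.fixedPoints f) = 1 := by
    rw [Fintype.card_eq_one_iff]
    have hall : ∀ c, f c = c → c = 1 := by
      intro c hc
      obtain ⟨I, rfl⟩ := ClassGroup.mk0_surjective c
      rw [hf, ClassGroup.mk0_eq_mk0_iff] at hc
      obtain ⟨x, y, hx, hy, h⟩ := hc
      have := hfix I (nonZeroDivisors.ne_zero I.2) x y hx hy h
      exact (ClassGroup.mk0_eq_one_iff I.2).2 this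
    have h1 : f 1 = 1 := by
      have : (1 : ClassGroup (𝓞 F)) = ClassGroup.mk0 1 := (map_one _).symm
      rw [this, hf]
      congr 1
      apply Subtype.ext
      change Ideal.map s (1 : Ideal (𝓞 F)) = 1
      rw [Ideal.one_eq_top, Ideal.map_top]
    exact ⟨⟨1, h1⟩, fun c => Subtype.ext (hall _ c.2)⟩
  convert hmain using 1
  rw [← hone]
  
theorem norm_of_ideal (p N : ℕ) (hpodd : Odd p) (hF : Module.finrank ℚ F = p) (hN0 : N ≠ 0)
    (hcl : Fintype.card (ClassGroup (𝓞 F)) ≡ 1 [MOD p]) (I : Ideal (𝓞 F))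
    (hI : Ideal.absNorm I = N) : ∃ γ : F, Algebra.norm ℚ γ = (N : ℚ) := by
  have hI0 : I ≠ ⊥ := by
    rintro rfl
    rw [Ideal.absNorm_bot] at hI
    exact hN0 hI.symm
  have hImem : I ∈ nonZeroDivisors (Ideal (𝓞 F)) := mem_nonZeroDivisors_of_ne_zero hI0
  set h := Fintype.card (ClassGroup (𝓞 F)) with hh
  have hpos : 0 < h := Fintype.card_pos
  obtain ⟨k, hk⟩ := (Nat.modEq_iff_dvd' hpos).1 hcl.symm
  have h1 : ClassGroup.mk0 (⟨I, hImem⟩ ^ h : nonZeroDivisors (Ideal (𝓞 F))) = 1 := by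
    rw [map_pow, hh, pow_card_eq_one]
  obtain ⟨c, hc⟩ := (ClassGroup.mk0_eq_one_iff (pow_mem hImem h)).1 h1
  have hc' : I ^ h = Ideal.span {c} := hc
  have hn := congrArg Ideal.absNorm hc'
  rw [map_pow, hI, Ideal.absNorm_span_singleton] at hn
  obtain ⟨γ, hγ⟩ : ∃ γ : F, Algebra.norm ℚ γ = (N : ℚ) ^ h := by
    rcases Int.natAbs_eq (Algebra.norm ℤ c) with h2 | h2
    · refine ⟨c, ?_⟩
      rw [← Algebra.coe_norm_int, h2, ← hn]; simp
    · refine ⟨algebraMap ℚ F (-1) * c, ?_⟩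
      rw [map_mul, Algebra.norm_algebraMap, hF, hpodd.neg_one_pow, ← Algebra.coe_norm_int, h2, ← hn]
      simp
  refine ⟨algebraMap ℚ F (((N : ℚ) ^ k)⁻¹) * γ, ?_⟩
  rw [map_mul, hγ, Algebra.norm_algebraMap, hF, show h = p * k + 1 by omega, pow_succ, pow_mul,
    inv_pow, ← pow_mul, mul_comm k p, pow_mul]
  have : (N : ℚ) ≠ 0 := by exact_mod_cast hN0
  field_simp

end ClassNumber

section Cyclo

variable {F E : Type} [Field F] [NumberField F] [Field E] [NumberField E] [Algebra F E]

theorem unram_pow (m : ℕ) [NeZero m] [IsCyclotomicExtension {m} ℚ E] (p : ℕ)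
    (I : Ideal (𝓞 F)) (n : ℕ) (hn : n ≠ 0) (hI : I ^ p = Ideal.span {(n : 𝓞 F)})
    (l : ℕ) (hl : l.Prime) (hlm : ¬ l ∣ m) (hln : l ∣ n) : l ^ p ∣ n := by
  have : Fact l.Prime := ⟨hl⟩
  let Q : Ideal ℤ := Ideal.span {(l : ℤ)}
  have hQ0 : Q ≠ ⊥ := by
    simp only [Q, Ne, Ideal.span_singleton_eq_bot]
    exact_mod_cast hl.ne_zero
  have hQ : Q.IsPrime := by
    simp only [Q]
    rw [Ideal.span_singleton_prime (by exact_mod_cast hl.ne_zero)]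
    exact Nat.prime_iff_prime_int.1 hl
  have : Q.IsMaximal := hQ.isMaximal hQ0
  obtain ⟨⟨P, hP1, hP2⟩⟩ := Q.nonempty_primesOver (S := 𝓞 E)
  have := hP1
  have : P.LiesOver Q := hP2
  have hmap0 : Q.map (algebraMap ℤ (𝓞 E)) ≠ ⊥ := Ideal.map_ne_bot_of_ne_bot hQ0
  have hram := IsCyclotomicExtension.Rat.ramificationIdx_eq_of_not_dvd l E P hlm
  rw [Ideal.IsDedekindDomain.ramificationIdx_eq_multiplicity Q P hmap0] at hram
  have hmapeq : Q.map (algebraMap ℤ (𝓞 E)) = Ideal.span {(l : 𝓞 E)} := by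
    simp [Q, Ideal.map_span]
  rw [hmapeq] at hram hmap0
  have hP0 : P ≠ ⊥ := by
    refine ne_bot_of_le_ne_bot hmap0 ?_
    rw [← hmapeq]
    exact Ideal.map_le_of_le_comap (P.over_def Q).le
  have hPp : Prime P := Ideal.prime_of_isPrime hP0 hP1
  have hE : (I.map (algebraMap (𝓞 F) (𝓞 E))) ^ p = Ideal.span {(n : 𝓞 E)} := by
    rw [← Ideal.map_pow, hI, Ideal.map_span, Set.image_singleton, map_natCast]
  obtain ⟨a, k, hk, hnk⟩ := Nat.exists_eq_pow_mul_and_not_dvd hn l hl.ne_one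
  have hfin : ∀ J : Ideal (𝓞 E), J ≠ 0 → FiniteMultiplicity P J := fun J hJ =>
    FiniteMultiplicity.of_prime_left hPp hJ
  have hk0 : k ≠ 0 := by rintro rfl; simp at hk
  have hPk : ¬ P ∣ Ideal.span {(k : 𝓞 E)} := by
    rw [Ideal.dvd_iff_le, Ideal.span_singleton_le_iff_mem]
    intro h
    have : (k : ℤ) ∈ Q := by
      rw [P.over_def Q, Ideal.mem_comap]
      simpa using h
    rw [Ideal.mem_span_singleton] at this
    exact hk (by exact_mod_cast this)
  have hspan : ∀ j : ℕ, j ≠ 0 → Ideal.span {(j : 𝓞 E)} ≠ 0 := by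
    intro j hj
    rw [Ne, Ideal.zero_eq_bot, Ideal.span_singleton_eq_bot]
    exact_mod_cast hj
  have hmult : multiplicity P (Ideal.span {(n : 𝓞 E)}) = a := by
    have : Ideal.span {(n : 𝓞 E)} = Ideal.span {(l : 𝓞 E)} ^ a * Ideal.span {(k : 𝓞 E)} := by
      rw [Ideal.span_singleton_pow, Ideal.span_singleton_mul_span_singleton, hnk]
      push_cast; rfl
    rw [this, multiplicity_mul hPp (by rw [← this]; exact hfin _ (hspan n hn)),
      FiniteMultiplicity.multiplicity_pow hPp (hfin _ (hspan l hl.ne_zero)), hram,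
      multiplicity_eq_zero.2 hPk]
    simp
  have hI0 : I.map (algebraMap (𝓞 F) (𝓞 E)) ≠ 0 ∨ p = 0 := by
    by_cases hp : p = 0
    · exact Or.inr hp
    · left
      intro h
      rw [h, zero_pow hp] at hE
      exact hspan n hn hE.symm
  rcases hI0 with hI0 | hp
  · rw [← hE, FiniteMultiplicity.multiplicity_pow hPp (hfin _ hI0)] at hmult
    have ha : a ≠ 0 := by
      rintro rfl
      rw [pow_zero, one_mul] at hnk
      exact hk (hnk ▸ hln)
    have hpa : p ∣ a := ⟨_, hmult.symm⟩
    rw [hnk]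
    exact Dvd.dvd.mul_right (pow_dvd_pow l (Nat.le_of_dvd (Nat.pos_of_ne_zero ha) hpa)) k
  · rw [hp, pow_zero]; exact one_dvd _

theorem split_ideal (m N : ℕ) [NeZero m] [IsCyclotomicExtension {m} ℚ E] (hN : N.Prime)
    (hNm : ¬ N ∣ m) (h1 : (N : ZMod m) = 1) : ∃ I : Ideal (𝓞 F), Ideal.absNorm I = N := by
  have : Fact N.Prime := ⟨hN⟩
  let Q : Ideal ℤ := Ideal.span {(N : ℤ)}
  have hQ0 : Q ≠ ⊥ := by
    simp only [Q, Ne, Ideal.span_singleton_eq_bot]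
    exact_mod_cast hN.ne_zero
  have hQ : Q.IsPrime := by
    simp only [Q]
    rw [Ideal.span_singleton_prime (by exact_mod_cast hN.ne_zero)]
    exact Nat.prime_iff_prime_int.1 hN
  have : Q.IsMaximal := hQ.isMaximal hQ0
  obtain ⟨⟨P, hP1, hP2⟩⟩ := Q.nonempty_primesOver (S := 𝓞 E)
  have := hP1
  have : P.LiesOver Q := hP2
  have hdeg := IsCyclotomicExtension.Rat.inertiaDeg_eq_of_not_dvd N E P hNm
  rw [h1, orderOf_one] at hdeg
  let I := P.under (𝓞 F)
  have ht := Ideal.inertiaDeg_tower (R := ℤ) I P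
  rw [hdeg] at ht
  have hI1 : I.inertiaDeg ℤ = 1 := Nat.eq_one_of_mul_eq_one_right ht.symm
  have : I.LiesOver Q := Ideal.LiesOver.tower_bot P I Q
  have : I.IsMaximal := Ideal.IsMaximal.of_liesOver_isMaximal I Q
  refine ⟨I, ?_⟩
  rw [Ideal.absNorm_eq_pow_inertiaDeg' I hN]
  rw [Ideal.inertiaDeg'_eq_inertiaDeg, hI1, pow_one]

theorem exists_norm (p N : ℕ) (hp : p.Prime) (hpodd : Odd p) (hN : N.Prime) (hNp : N ≠ p)
    (h1 : p ^ 2 ∣ N - 1) [IsCyclotomicExtension {p ^ 2} ℚ E] [IsGalois ℚ F]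
    [IsScalarTower ℚ F E]
    (hF : Module.finrank ℚ F = p) (z : E) (hz : IsPrimitiveRoot z (p ^ 2)) (τ : E ≃ₐ[ℚ] E)
    (hτ : τ z = z ^ (p + 1)) (hσ : orderOf (τ.restrictNormal F) = p) :
    ∃ γ : F, Algebra.norm ℚ γ = (N : ℚ) := by
  have hpf : Fact p.Prime := ⟨hp⟩
  have : NeZero (p ^ 2) := ⟨pow_ne_zero _ hp.ne_zero⟩
  let σ := τ.restrictNormal F
  let s := RingOfIntegers.mapRingEquiv (σ : F ≃+* F)
  have hs : ∀ x : 𝓞 F, ((s x : 𝓞 F) : F) = σ x := fun x =>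
    RingOfIntegers.mapRingEquiv_apply (σ : F ≃+* F) x
  let zi : 𝓞 E := hz.toInteger
  have hzi : IsPrimitiveRoot zi (p ^ 2) := hz.toInteger_isPrimitiveRoot
  let π : 𝓞 F := RingOfIntegers.norm F (zi - 1)
  have hnZ : Algebra.norm ℤ (zi - 1) = p :=
    IsPrimitiveRoot.norm_toInteger_sub_one_of_prime_ne_two (k := 1) (p := p) hz
      (by rintro rfl; exact absurd hpodd (by decide))
  have hπn : Algebra.norm ℤ π = p := by
    have : ((Algebra.norm ℤ π : ℤ) : ℚ) = ((Algebra.norm ℤ (zi - 1) : ℤ) : ℚ) := by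
      rw [Algebra.coe_norm_int, Algebra.coe_norm_int, RingOfIntegers.coe_norm, Algebra.norm_norm]
    rw [hnZ] at this
    exact_mod_cast this
  have habs : Ideal.absNorm (Ideal.span {π}) = p := by
    rw [Ideal.absNorm_span_singleton, hπn]; rfl
  have hπ0 : Ideal.span {π} ≠ ⊥ := by
    rw [Ne, ← Ideal.absNorm_eq_zero_iff, habs]; exact hp.ne_zero
  have hinv : (Ideal.span {π}).map s = Ideal.span {π} := by
    rw [Ideal.map_span, Set.image_singleton, Ideal.span_singleton_eq_span_singleton]
    have hcop : (p + 1).Coprime (p ^ 2) := by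
      apply Nat.Coprime.pow_right
      simp
    have hassoc := hzi.associated_sub_one_pow_sub_one_of_coprime hcop
    have h2 : Associated π (RingOfIntegers.norm F (zi ^ (p + 1) - 1)) := hassoc.map _
    have h3 : s π = RingOfIntegers.norm F (zi ^ (p + 1) - 1) := by
      apply RingOfIntegers.coe_injective
      have h4 := Algebra.norm_eq_of_equiv_equiv (σ : F ≃+* F) (τ : E ≃+* E)
        (by ext x; exact AlgEquiv.restrictNormal_commutes τ F x) ((zi - 1 : 𝓞 E) : E)
      have h5 : ((s π : 𝓞 F) : F) = σ (π : F) := hs π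
      have h6 : τ ((zi - 1 : 𝓞 E) : E) = ((zi ^ (p + 1) - 1 : 𝓞 E) : E) := by
        simp only [map_sub, map_pow, map_one]
        change τ z - 1 = z ^ (p + 1) - 1
        rw [hτ]
      change ((s π : 𝓞 F) : F) = ((RingOfIntegers.norm F (zi ^ (p + 1) - 1) : 𝓞 F) : F)
      rw [h5, RingOfIntegers.coe_norm, RingOfIntegers.coe_norm, ← h6, h4]
      exact σ.apply_symm_apply _
    rw [h3]
    exact h2.symm
  have hπp := invariant_pow p hF σ hσ s hs (Ideal.span {π}) hπ0 hinv
  rw [habs] at hπp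
  have hprin := principal_of_pow p hp π hπp (fun I n hn hI l hl hlp hln =>
    unram_pow (E := E) (p ^ 2) p I n hn hI l hl (fun h => hlp
      ((Nat.prime_dvd_prime_iff_eq hl hp).1 (hl.dvd_of_dvd_pow h))) hln)
  have hcl : Fintype.card (ClassGroup (𝓞 F)) ≡ 1 [MOD p] := by
    apply class_number_modEq p hp s
    · intro x
      apply RingOfIntegers.coe_injective
      have h7 : ∀ (i : ℕ), ((s^[i] x : 𝓞 F) : F) = (σ ^ i) (x : F) := by
        intro i
        induction i with
        | zero => simp
        | succ i ih => rw [Function.iterate_succ_apply', hs, ih, pow_succ']; rfl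
      have h8 : σ ^ p = 1 := by rw [← hσ]; exact pow_orderOf_eq_one _
      change ((s^[p] x : 𝓞 F) : F) = (x : F)
      rw [h7, h8]; rfl
    · exact fixed_principal p hp hpodd hF σ hσ s hs (fun I n => hprin n I)
  obtain ⟨I, hI⟩ := split_ideal (F := F) (E := E) (p ^ 2) N hN
    (fun h => hNp ((Nat.prime_dvd_prime_iff_eq hN hp).1 (hN.dvd_of_dvd_pow h)))
    (by
      have := (Nat.modEq_iff_dvd' hN.one_lt.le).2 h1
      have h9 := (ZMod.natCast_eq_natCast_iff 1 N (p ^ 2)).2 this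
      rw [← h9]; simp)
  exact norm_of_ideal p N hpodd hF hN.ne_zero hcl I hI

end Cyclo

theorem forward_aux (p N : ℕ) (hp : p.Prime) (hpodd : Odd p) (hN : N.Prime) (hNp : N ≠ p)
    (h1 : p ^ 2 ∣ N - 1)
    (E : Type) [Field E] [NumberField E] [IsCyclotomicExtension {p ^ 2} ℚ E]
    (K L : Type) [Field K] [NumberField K] [Field L] [NumberField L] [Algebra K L]
    (irr : Irreducible (X ^ p - C (N : K)))
    (ζ : K) (hζ : IsPrimitiveRoot ζ p)
    (hKgen : Algebra.adjoin ℚ {ζ} = (⊤ : Subalgebra ℚ K))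
    (α : L) (hα : α ^ p = (N : L))
    (hLgen : Algebra.adjoin K {α} = (⊤ : Subalgebra K L)) :
    ∃ x : L, Algebra.norm K x = ζ := by
  have hpf : Fact p.Prime := ⟨hp⟩
  have : NeZero p := ⟨hp.ne_zero⟩
  have hp2 : NeZero (p ^ 2) := ⟨pow_ne_zero _ hp.ne_zero⟩
  have hcK : IsCyclotomicExtension {p} ℚ K := by
    rw [IsCyclotomicExtension.iff_singleton]
    refine ⟨⟨ζ, hζ⟩, fun x => ?_⟩
    have hx : x ∈ Algebra.adjoin ℚ {ζ} := by rw [hKgen]; trivial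
    exact Algebra.adjoin_mono (by simpa using hζ.pow_eq_one) hx
  have hgal : IsGalois ℚ E := IsCyclotomicExtension.isGalois {p ^ 2} ℚ E
  have hirr2 : Irreducible (cyclotomic (p ^ 2) ℚ) := cyclotomic.irreducible_rat hp2.pos
  have hirr1 : Irreducible (cyclotomic p ℚ) := cyclotomic.irreducible_rat hp.pos
  have hrE : Module.finrank ℚ E = p * (p - 1) := by
    rw [IsCyclotomicExtension.finrank E hirr2, Nat.totient_prime_pow hp two_pos]
    simp
  have hrK : Module.finrank ℚ K = p - 1 := by
    rw [IsCyclotomicExtension.finrank K hirr1, Nat.totient_prime hp]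
  have hp1 : 0 < p - 1 := by have := hp.two_le; omega
  let z : E := IsCyclotomicExtension.zeta (p ^ 2) ℚ E
  have hz : IsPrimitiveRoot z (p ^ 2) := IsCyclotomicExtension.zeta_spec (p ^ 2) ℚ E
  have hzp : IsPrimitiveRoot (z ^ p) p := hz.pow hp2.pos (by ring)
  -- the embedding of K
  let pbK := hζ.powerBasis ℚ
  have hpbK : pbK.gen = ζ := hζ.powerBasis_gen ℚ
  have hroot : aeval (z ^ p) (minpoly ℚ pbK.gen) = 0 := by
    rw [hpbK, ← cyclotomic_eq_minpoly_rat hζ hp.pos, cyclotomic_eq_minpoly_rat hzp hp.pos]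
    exact minpoly.aeval _ _
  let φ : K →ₐ[ℚ] E := pbK.lift (z ^ p) hroot
  have hφ : φ ζ = z ^ p := by
    have h : φ pbK.gen = z ^ p := pbK.lift_gen (z ^ p) hroot
    exact (congrArg φ hpbK).symm.trans h
  let _ : Algebra K E := φ.toRingHom.toAlgebra
  have hamap : ∀ k, algebraMap K E k = φ k := fun _ => rfl
  have : IsScalarTower ℚ K E := IsScalarTower.of_algebraMap_eq (fun q => (φ.commutes q).symm)
  have hKE : Module.finrank K E = p := by
    have h := Module.finrank_mul_finrank ℚ K E
    rw [hrK, hrE, mul_comm p] at h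
    exact Nat.eq_of_mul_eq_mul_left hp1 h
  -- the automorphism
  have hcop : (p + 1).Coprime (p ^ 2) := by
    apply Nat.Coprime.pow_right
    simp
  let τ : E ≃ₐ[ℚ] E := IsCyclotomicExtension.fromZetaAut (hz.pow_of_coprime (p + 1) hcop) hirr2
  have hτ : τ z = z ^ (p + 1) := IsCyclotomicExtension.fromZetaAut_spec _ hirr2
  let pbE := hz.powerBasis ℚ
  have hpbE : pbE.gen = z := hz.powerBasis_gen ℚ
  have hz1 : z ^ p ^ 2 = 1 := hz.pow_eq_one
  have hτi : ∀ i : ℕ, (τ ^ i) z = z ^ (1 + i * p) := by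
    intro i
    induction i with
    | zero => simp
    | succ i ih =>
      rw [pow_succ', AlgEquiv.mul_apply, ih, map_pow, hτ, ← pow_mul]
      have : (p + 1) * (1 + i * p) = (1 + (i + 1) * p) + p ^ 2 * i := by ring
      rw [this, pow_add, pow_mul z (p ^ 2), hz1, one_pow, mul_one]
  have hτp : τ ^ p = 1 := by
    have h : ((τ ^ p : E ≃ₐ[ℚ] E) : E →ₐ[ℚ] E) = ((1 : E ≃ₐ[ℚ] E) : E →ₐ[ℚ] E) := by
      apply pbE.algHom_ext
      rw [hpbE]
      change (τ ^ p) z = z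
      rw [hτi, pow_add, ← sq, hz1, pow_one, mul_one]
    exact AlgEquiv.coe_algHom_injective h
  have hz0 : z ≠ 0 := hz.ne_zero hp2.ne
  have hτ1 : τ ≠ 1 := by
    intro h
    rw [h] at hτ
    have h2 : z ^ p * z = 1 * z := by rw [← pow_succ, ← hτ, one_mul]; rfl
    exact hzp.ne_one hp.one_lt (mul_right_cancel₀ hz0 h2)
  have hτo : orderOf τ = p := orderOf_eq_prime hτp hτ1
  -- the subgroup
  have hcomm : ∀ a b : E ≃ₐ[ℚ] E, a * b = b * a := by
    intro a b
    apply (IsCyclotomicExtension.Rat.galEquivZMod (p ^ 2) E).injective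
    rw [map_mul, map_mul, mul_comm]
  have hnorm : ∀ H : Subgroup (E ≃ₐ[ℚ] E), H.Normal := by
    intro H
    refine ⟨fun n hn g => ?_⟩
    rwa [hcomm g n, mul_assoc, mul_inv_cancel, mul_one]
  let T := Subgroup.zpowers τ
  have : T.Normal := hnorm T
  have hTc : Nat.card T = p := by rw [Nat.card_zpowers, hτo]
  have hGc : Nat.card (E ≃ₐ[ℚ] E) = p * (p - 1) := by
    rw [IsGalois.card_aut_eq_finrank, hrE]
  have hTi : T.index = p - 1 := by
    have h := T.card_mul_index
    rw [hTc, hGc] at h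
    exact Nat.eq_of_mul_eq_mul_left hp.pos h
  obtain ⟨H, hH⟩ := Subgroup.exists_right_complement'_of_coprime (N := T) (by
    rw [hTc, hTi, hp.coprime_iff_not_dvd]
    exact Nat.not_dvd_of_pos_of_lt hp1 (by omega))
  have hHc : Nat.card H = p - 1 := by
    have h := hH.card_mul_card
    rw [hTc, hGc] at h
    exact Nat.eq_of_mul_eq_mul_left hp.pos h
  have : H.Normal := hnorm H
  let F := IntermediateField.fixedField H
  have hFgal : IsGalois ℚ F := IsGalois.of_fixedField_normal_subgroup H
  have hF : Module.finrank ℚ F = p := by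
    have h := Module.finrank_mul_finrank ℚ F E
    rw [IntermediateField.finrank_fixedField_eq_card, hHc, hrE] at h
    exact Nat.eq_of_mul_eq_mul_right hp1 h
  have hσo : orderOf (τ.restrictNormal F) = p := by
    apply orderOf_eq_prime
    · have := map_pow (AlgEquiv.restrictNormalHom (F := ℚ) (K₁ := E) F) τ p
      rw [hτp, map_one] at this
      exact this.symm
    · intro h
      have hmem : τ ∈ H := by
        rw [← IntermediateField.fixingSubgroup_fixedField H,
          IntermediateField.mem_fixingSubgroup_iff]
        intro x hx
        have h2 := AlgEquiv.restrictNormal_commutes τ F ⟨x, hx⟩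
        rw [h] at h2
        exact h2.symm
      have := (Subgroup.disjoint_def.1 hH.disjoint) (Subgroup.mem_zpowers τ) hmem
      exact hτ1 this
  obtain ⟨γ, hγ⟩ := exists_norm (F := F) (E := E) p N hp hpodd hN hNp h1 hF z hz τ hτ hσo
  -- transport to `K`
  have hτK : ∀ k : K, τ (algebraMap K E k) = algebraMap K E k := by
    intro k
    have h : (τ : E →ₐ[ℚ] E).comp φ = φ := by
      apply pbK.algHom_ext
      rw [hpbK]
      change τ (φ ζ) = φ ζ
      rw [hφ, map_pow, hτ, ← pow_mul]
      have : (p + 1) * p = p ^ 2 + p := by ring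
      rw [this, pow_add, hz1, one_mul]
    exact DFunLike.congr_fun h k
  let σ : E ≃ₐ[K] E := AlgEquiv.ofRingEquiv (f := (τ : E ≃+* E)) hτK
  have hσi : ∀ (i : ℕ) (x : E), (σ ^ i) x = (τ ^ i) x := by
    intro i
    induction i with
    | zero => intro x; rfl
    | succ i ih =>
      intro x
      rw [pow_succ', pow_succ', AlgEquiv.mul_apply, AlgEquiv.mul_apply, ih]
      rfl
  refine symbol_symm p N hp hN.ne_zero irr ζ hζ α hα hLgen hKE z (hφ.symm) σ ?_ ?_ (γ : E) ?_
  · rw [hamap, hφ, ← pow_succ]; exact hτ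
  · ext x
    rw [hσi, hτp]; rfl
  · have h4 := Algebra.norm_eq_prod_automorphisms ℚ γ
    have hcard : Fintype.card (F ≃ₐ[ℚ] F) = p := by
      rw [← Nat.card_eq_fintype_card, IsGalois.card_aut_eq_finrank, hF]
    rw [prod_gal (τ.restrictNormal F) (by rw [hσo, hcard]), hσo, hγ] at h4
    have h5 := congrArg (algebraMap F E) h4
    rw [map_prod] at h5
    have h6 : algebraMap F E (algebraMap ℚ F (N : ℚ)) = (N : E) := by simp
    rw [← h6, h5]
    apply Finset.prod_congr rfl
    intro i _
    rw [hσi]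
    have h7 := AlgEquiv.restrictNormal_commutes (τ ^ i) F γ
    have h8 := map_pow (AlgEquiv.restrictNormalHom (F := ℚ) (K₁ := E) F) τ i
    have h9 : (τ ^ i).restrictNormal F = (τ.restrictNormal F) ^ i := h8
    rw [h9] at h7
    exact h7.symm

theorem stmt2 (p N : ℕ) (hp : p.Prime) (hpodd : Odd p) (hN : N.Prime) (hNp : N ≠ p)
    (hmod : N ≡ 1 [MOD p])
    (K L : Type) [Field K] [NumberField K] [Field L] [NumberField L] [Algebra K L]
    (ζ : K) (hζ : IsPrimitiveRoot ζ p)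
    (hKgen : Algebra.adjoin ℚ {ζ} = (⊤ : Subalgebra ℚ K))
    (α : L) (hα : α ^ p = (N : L))
    (hLgen : Algebra.adjoin K {α} = (⊤ : Subalgebra K L)) :
    N ≡ 1 [MOD p ^ 2] ↔ ∃ x : L, Algebra.norm K x = ζ := by
  have hNf : Fact N.Prime := ⟨hN⟩
  have hd : p ∣ N - 1 := (Nat.modEq_iff_dvd' hN.one_lt.le).1 hmod.symm
  constructor
  · intro h
    have h2 : p ^ 2 ∣ N - 1 := (Nat.modEq_iff_dvd' hN.one_lt.le).1 h.symm
    have hp2 : NeZero (p ^ 2) := ⟨pow_ne_zero _ hp.ne_zero⟩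
    have hp2' : NeZero ((p ^ 2 : ℕ) : ℚ) := ⟨by exact_mod_cast hp2.ne⟩
    have hc : IsCyclotomicExtension {p ^ 2} ℚ (CyclotomicField (p ^ 2) ℚ) :=
      CyclotomicField.isCyclotomicExtension (p ^ 2) ℚ
    exact forward_aux p N hp hpodd hN hNp h2 (CyclotomicField (p ^ 2) ℚ) K L
      (kummer_irr p N hp hd ζ hζ hKgen) ζ hζ hKgen α hα hLgen
  · rintro ⟨x, hx⟩
    exact ((Nat.modEq_iff_dvd' hN.one_lt.le).2
      (backward p N hp hNp hd K L ζ hζ hKgen α hα hLgen x hx)).symm
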